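/- Let L ≥ 1 and K = ⌊(L+1)/2⌋. For every α ∈ ℝ^L, ∏_{1 ≤ j < k ≤ L} sgn(α_k − α_j) = Pf T^α. -/

import Mathlib

open Finset

noncomputable section

/-- Pfaffian of a `2K × 2K` matrix, via the sum over the symmetric group:
`Pf U = (1/(2^K K!)) Σ_{τ∈S_{2K}} sgn(τ) ∏_{k=1}^K U[τ(2k−1),τ(2k)]`. -/
def pf {R : Type*} [Field R] {J : ℕ} (U : Matrix (Fin (2*J)) (Fin (2*J)) R) : R :=
  ((2:R)^J * (Nat.factorial J : R))⁻¹ *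
    ∑ τ : Equiv.Perm (Fin (2*J)), ((Equiv.Perm.sign τ : ℤ) : R) *
      ∏ j : Fin J, U (τ ⟨2*(j:ℕ), by have := j.isLt; omega⟩)
                     (τ ⟨2*(j:ℕ)+1, by have := j.isLt; omega⟩)

/-- The `2K × 2K` antisymmetric matrix `T^α`, `K = ⌊(L+1)/2⌋` (`0`-based indices):
`T^α[j,k] = sgn(α_k−α_j)` if `j,k ≤ L` and `T^α[j,k] = sgn(k−j)` otherwise. -/
def Tmat {L : ℕ} (α : Fin L → ℝ) : Matrix (Fin (2*((L+1)/2))) (Fin (2*((L+1)/2))) ℝ :=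
  fun j k => if h : (j:ℕ) < L ∧ (k:ℕ) < L
    then Real.sign (α ⟨(k:ℕ), h.2⟩ - α ⟨(j:ℕ), h.1⟩)
    else Real.sign (((k:ℕ):ℝ) - ((j:ℕ):ℝ))

lemma sum_perm_succ (n : ℕ) (f : (Fin (n+1) → Fin (n+1)) → ℝ) :
    ∑ τ : Equiv.Perm (Fin (n+1)), ((Equiv.Perm.sign τ : ℤ) : ℝ) * f τ =
    ∑ p : Fin (n+1), ∑ σ : Equiv.Perm (Fin n), (-1:ℝ)^(p:ℕ) * (((Equiv.Perm.sign σ : ℤ) : ℝ) *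
      f (Fin.cons p (fun i => p.succAbove (σ i)))) := by
  rw [← Equiv.sum_comp Equiv.Perm.decomposeFin.symm, Fintype.sum_prod_type]
  refine Finset.sum_congr rfl fun p _ => ?_
  refine Fin.cases ?_ (fun i => ?_) p
  · refine Finset.sum_congr rfl fun σ _ => ?_
    have : (⇑(Equiv.Perm.decomposeFin.symm ((0 : Fin (n+1)), σ)) : Fin (n+1) → Fin (n+1)) =
        Fin.cons 0 (fun i => (0 : Fin (n+1)).succAbove (σ i)) := by
      funext x
      refine Fin.cases ?_ (fun j => ?_) x
      · simp
      · simp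
    rw [this]
    simp
  · rw [← Equiv.sum_comp (Equiv.mulLeft i.cycleRange) (fun σ : Equiv.Perm (Fin n) => (-1:ℝ)^((i.succ : Fin (n+1)):ℕ) * (((Equiv.Perm.sign σ : ℤ) : ℝ) *
      f (Fin.cons i.succ (fun j => i.succ.succAbove (σ j)))))]
    refine Finset.sum_congr rfl fun σ _ => ?_
    have : (⇑(Equiv.Perm.decomposeFin.symm (i.succ, σ)) : Fin (n+1) → Fin (n+1)) =
        Fin.cons i.succ (fun j => i.succ.succAbove ((Equiv.mulLeft i.cycleRange σ : Equiv.Perm (Fin n)) j)) := by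
      funext x
      refine Fin.cases ?_ (fun j => ?_) x
      · simp
      · simp only [Equiv.Perm.decomposeFin_symm_apply_succ, Fin.cons_succ, Equiv.coe_mulLeft, Equiv.Perm.mul_apply]
        rw [Fin.succAbove_cycleRange]
    rw [this]
    simp only [Equiv.coe_mulLeft, Equiv.Perm.sign_mul, Fin.sign_cycleRange]
    rw [Equiv.Perm.decomposeFin.symm_sign]
    rw [if_neg (Fin.succ_ne_zero i)]
    push_cast
    have h : ((-1:ℝ)^(i:ℕ)) * (-1)^(i:ℕ) = 1 := by rw [← mul_pow]; simp
    rw [Fin.val_succ, pow_succ]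
    generalize f _ = x
    linear_combination (((Equiv.Perm.sign σ : ℤ):ℝ) * x) * h

def Sg {n : ℕ} (j k : Fin n) : ℝ := Real.sign (((k:ℕ):ℝ) - ((j:ℕ):ℝ))

def PS {J : ℕ} (U : Fin (2*J) → Fin (2*J) → ℝ) : ℝ :=
    ∑ τ : Equiv.Perm (Fin (2*J)), ((Equiv.Perm.sign τ : ℤ) : ℝ) *
      ∏ j : Fin J, U (τ ⟨2*(j:ℕ), by have := j.isLt; omega⟩)
                     (τ ⟨2*(j:ℕ)+1, by have := j.isLt; omega⟩)

lemma Sg_of_lt {n : ℕ} {j k : Fin n} (h : j < k) : Sg j k = 1 := by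
  unfold Sg
  apply Real.sign_of_pos
  have : ((j:ℕ):ℝ) < (k:ℕ) := by exact_mod_cast h
  linarith
lemma Sg_of_gt {n : ℕ} {j k : Fin n} (h : k < j) : Sg j k = -1 := by
  unfold Sg
  apply Real.sign_of_neg
  have : ((k:ℕ):ℝ) < (j:ℕ) := by exact_mod_cast h
  linarith
lemma Sg_self {n : ℕ} (j : Fin n) : Sg j j = 0 := by simp [Sg]

lemma Sg_mono {m n : ℕ} (g : Fin m → Fin n) (hg : StrictMono g) (j k : Fin m) :
    Sg (g j) (g k) = Sg j k := by
  rcases lt_trichotomy j k with h | h | h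
  · rw [Sg_of_lt h, Sg_of_lt (hg h)]
  · subst h; rw [Sg_self, Sg_self]
  · rw [Sg_of_gt h, Sg_of_gt (hg h)]

lemma alt1 (m : ℕ) : ∑ q ∈ Finset.range m, (-1:ℝ)^q = (1 - (-1)^m)/2 := by
  induction m with
  | zero => simp
  | succ m ih => rw [Finset.sum_range_succ, ih, pow_succ]; ring

lemma alt2 (J p : ℕ) (hp : p ≤ 2*J+1) :
    ∑ q ∈ Finset.range (2*J+1), (-1:ℝ)^q * (if p ≤ q then 1 else -1) = (-1)^p := by
  have h : ∀ q, (-1:ℝ)^q * (if p ≤ q then 1 else -1) = (-1)^q - 2 * (if q < p then (-1)^q else 0) := by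
    intro q
    by_cases hq : p ≤ q
    · rw [if_pos hq, if_neg (by omega)]; ring
    · rw [if_neg hq, if_pos (by omega)]; ring
  simp_rw [h]
  rw [Finset.sum_sub_distrib, ← Finset.mul_sum, ← Finset.sum_filter]
  have : (Finset.range (2*J+1)).filter (fun q => q < p) = Finset.range p := by
    ext q; simp; omega
  rw [this, alt1, alt1, pow_succ, pow_mul]
  norm_num
  ring

lemma PS_succ (J : ℕ) : PS (J := J+1) Sg = (2*((J:ℝ)+1)) * PS (J := J) Sg := by
  have e : PS (J := J+1) Sg = ∑ τ : Equiv.Perm (Fin (2*J+1+1)), ((Equiv.Perm.sign τ : ℤ) : ℝ) *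
      (fun t : Fin (2*J+1+1) → Fin (2*J+1+1) => ∏ j : Fin (J+1), Sg (t ⟨2*(j:ℕ), by have := j.isLt; omega⟩)
                     (t ⟨2*(j:ℕ)+1, by have := j.isLt; omega⟩)) τ := rfl
  refine e.trans ((sum_perm_succ (2*J+1) (fun t : Fin (2*J+1+1) → Fin (2*J+1+1) => ∏ j : Fin (J+1), Sg (t ⟨2*(j:ℕ), by have := j.isLt; omega⟩)
                     (t ⟨2*(j:ℕ)+1, by have := j.isLt; omega⟩))).trans ?_)
  have key : ∀ p : Fin (2*J+1+1), ∑ σ : Equiv.Perm (Fin (2*J+1)), (-1:ℝ)^(p:ℕ) * (((Equiv.Perm.sign σ : ℤ) : ℝ) *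
      (fun t : Fin (2*J+1+1) → Fin (2*J+1+1) => ∏ j : Fin (J+1), Sg (t ⟨2*(j:ℕ), by have := j.isLt; omega⟩)
                     (t ⟨2*(j:ℕ)+1, by have := j.isLt; omega⟩)) (Fin.cons p (fun i => p.succAbove (σ i)))) = PS (J := J) Sg := by
    intro p
    rw [← Finset.mul_sum]
    rw [sum_perm_succ (2*J) (fun s => (fun t : Fin (2*J+1+1) → Fin (2*J+1+1) => ∏ j : Fin (J+1), Sg (t ⟨2*(j:ℕ), by have := j.isLt; omega⟩)
                     (t ⟨2*(j:ℕ)+1, by have := j.isLt; omega⟩)) (Fin.cons p (fun i => p.succAbove (s i))))]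
    have key2 : ∀ q : Fin (2*J+1), ∑ σ : Equiv.Perm (Fin (2*J)), (-1:ℝ)^(q:ℕ) * (((Equiv.Perm.sign σ : ℤ) : ℝ) *
       (fun s => (fun t : Fin (2*J+1+1) → Fin (2*J+1+1) => ∏ j : Fin (J+1), Sg (t ⟨2*(j:ℕ), by have := j.isLt; omega⟩)
                     (t ⟨2*(j:ℕ)+1, by have := j.isLt; omega⟩)) (Fin.cons p (fun i => p.succAbove (s i)))) 
          (Fin.cons q (fun i => q.succAbove (σ i)))) = ((-1:ℝ)^(q:ℕ) * (if (p:ℕ) ≤ q then 1 else -1)) * PS (J := J) Sg := by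
      intro q
      unfold PS
      rw [Finset.mul_sum]
      refine Finset.sum_congr rfl fun σ _ => ?_
      beta_reduce
      rw [Fin.prod_univ_succ]
      have h0 : Sg p (p.succAbove q) = if (p:ℕ) ≤ q then 1 else -1 := by
        split_ifs with h
        · apply Sg_of_lt
          rw [Fin.succAbove_of_le_castSucc _ _ (by simpa [Fin.le_def] using h)]
          simp [Fin.lt_def]; omega
        · apply Sg_of_gt
          rw [Fin.succAbove_of_castSucc_lt _ _ (by simpa [Fin.lt_def] using h)]
          simpa [Fin.lt_def] using h
      have h1 : ∀ j k : Fin (2*J), Sg (p.succAbove (q.succAbove (σ j))) (p.succAbove (q.succAbove (σ k))) = Sg (σ j) (σ k) := by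
        intro j k
        rw [Sg_mono _ (Fin.strictMono_succAbove p), Sg_mono _ (Fin.strictMono_succAbove q)]
      rw [← h0]
      simp_rw [← h1]
      have : ∀ a b c d : ℝ, a * (b * (c * d)) = a * c * (b * d) := by intros; ring
      rw [this]
      rfl
    rw [Finset.sum_congr rfl (fun q _ => key2 q), ← Finset.sum_mul]
    rw [Fin.sum_univ_eq_sum_range (fun q => (-1:ℝ)^q * (if (p:ℕ) ≤ q then 1 else -1)), alt2 J p (by omega),
      ← mul_assoc, ← mul_pow]
    simp
  rw [Finset.sum_congr rfl (fun q _ => key q)]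
  rw [Finset.sum_const, Finset.card_univ, Fintype.card_fin, nsmul_eq_mul]
  push_cast
  ring

lemma PS_Sg (J : ℕ) : PS (J := J) Sg = 2^J * (Nat.factorial J : ℝ) := by
  induction J with
  | zero => simp [PS]
  | succ J ih => rw [PS_succ, ih, pow_succ, Nat.factorial_succ]; push_cast; ring

lemma PS_perm {J : ℕ} (U : Fin (2*J) → Fin (2*J) → ℝ) (σ : Equiv.Perm (Fin (2*J))) :
    PS (fun j k => U (σ j) (σ k)) = ((Equiv.Perm.sign σ : ℤ) : ℝ) * PS U := by
  unfold PS
  rw [← Equiv.sum_comp (Equiv.mulLeft σ) (fun τ => ((Equiv.Perm.sign τ : ℤ) : ℝ) *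
      ∏ j : Fin J, U (τ ⟨2*(j:ℕ), by have := j.isLt; omega⟩)
                     (τ ⟨2*(j:ℕ)+1, by have := j.isLt; omega⟩)), Finset.mul_sum]
  refine Finset.sum_congr rfl fun τ _ => ?_
  simp only [Equiv.coe_mulLeft, Equiv.Perm.sign_mul, Equiv.Perm.mul_apply]
  rcases Int.units_eq_one_or (Equiv.Perm.sign σ) with h | h <;> simp [h]

lemma even_case (J : ℕ) (β : Fin (2*J) → ℝ) :
    PS (J := J) (fun j k => Real.sign (β k - β j)) =
      (∏ j : Fin (2*J), ∏ k ∈ Finset.Ioi j, Real.sign (β k - β j)) * (2^J * (Nat.factorial J : ℝ)) := by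
  by_cases hβ : Function.Injective β
  · set σ := Tuple.sort β with hσ
    have hm : StrictMono (β ∘ σ) := (Tuple.monotone_sort β).strictMono_of_injective (hβ.comp σ.injective)
    have hS : ∀ j k, Real.sign (β (σ k) - β (σ j)) = Sg j k := by
      intro j k
      rcases lt_trichotomy j k with h | h | h
      · rw [Sg_of_lt h, Real.sign_of_pos (r := β (σ k) - β (σ j)) (sub_pos.2 (hm h))]
      · subst h; simp [Sg_self]
      · rw [Sg_of_gt h, Real.sign_of_neg (r := β (σ k) - β (σ j)) (sub_neg.2 (hm h))]
    have h1 := PS_perm (J := J) (fun j k => Real.sign (β k - β j)) σ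
    simp only [hS] at h1
    have h1' := h1.symm.trans (PS_Sg J)
    have h2 := Equiv.Perm.prod_Ioi_comp_eq_sign_mul_prod σ (f := fun j k => Real.sign (β k - β j)) (by
      intro i j; rw [← Real.sign_neg, neg_sub])
    simp only [hS] at h2
    have h3 : ∏ j : Fin (2*J), ∏ k ∈ Finset.Ioi j, Sg j k = 1 :=
      Finset.prod_eq_one fun j _ => Finset.prod_eq_one fun k hk => Sg_of_lt (Finset.mem_Ioi.1 hk)
    rw [h3] at h2
    rcases Int.units_eq_one_or (Equiv.Perm.sign σ) with h | h
    · simp [h] at h1' h2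
      linear_combination h1' + (2^J * (Nat.factorial J : ℝ)) * h2
    · simp [h] at h1' h2
      linear_combination -h1' - (2^J * (Nat.factorial J : ℝ)) * h2
  · have : ∃ a b, a < b ∧ β a = β b := by
      simp only [Function.Injective] at hβ
      push Not at hβ
      obtain ⟨a, b, h, hne⟩ := hβ
      rcases lt_or_gt_of_ne hne with h' | h'
      exacts [⟨a, b, h', h⟩, ⟨b, a, h', h.symm⟩]
    obtain ⟨a, b, hab, h⟩ := this
    rw [Finset.prod_eq_zero (Finset.mem_univ a) (Finset.prod_eq_zero (Finset.mem_Ioi.2 hab) (by simp [h]))]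
    have h1 := PS_perm (J := J) (fun j k => Real.sign (β k - β j)) (Equiv.swap a b)
    have hs : ∀ j, β (Equiv.swap a b j) = β j := by
      intro j
      rw [Equiv.swap_apply_def]; split_ifs with h1 h2 <;> simp_all
    simp only [hs, Equiv.Perm.sign_swap hab.ne] at h1
    push_cast at h1
    linarith

lemma prod_ext (L : ℕ) (β : Fin (L+1) → ℝ) (h : ∀ j : Fin L, β j.castSucc < β (Fin.last L)) :
   (∏ j : Fin (L+1), ∏ k ∈ Finset.Ioi j, Real.sign (β k - β j)) = 
   (∏ j : Fin L, ∏ k ∈ Finset.Ioi j, Real.sign (β k.castSucc - β j.castSucc)) := by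
  rw [Fin.prod_univ_castSucc]
  have : Finset.Ioi (Fin.last L) = ∅ := by ext; simp [Fin.le_last]
  rw [this, Finset.prod_empty, mul_one]
  refine Finset.prod_congr rfl fun j _ => ?_
  have : Finset.Ioi j.castSucc = insert (Fin.last L) ((Finset.Ioi j).map Fin.castSuccEmb) := by
    ext x
    refine Fin.lastCases ?_ (fun i => ?_) x
    · simp [Fin.castSucc_lt_last]
    · simp [Fin.castSucc_ne_last, Fin.le_last]
  rw [this, Finset.prod_insert (by simp [Fin.castSucc_ne_last]), Finset.prod_map, Real.sign_of_pos (sub_pos.2 (h j)), one_mul]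
  rfl

lemma prod_ext' (L n : ℕ) (hn : n = L+1) (β : Fin n → ℝ)
    (h : ∀ i j : Fin n, (i:ℕ) < L → (j:ℕ) = L → β i < β j) :
   (∏ j : Fin n, ∏ k ∈ Finset.Ioi j, Real.sign (β k - β j)) =
   (∏ j : Fin L, ∏ k ∈ Finset.Ioi j, Real.sign (β ⟨k, by omega⟩ - β ⟨j, by omega⟩)) := by
  subst hn
  exact prod_ext L β (fun j => h _ _ (by simp) (by simp))

lemma gen_case (L K : ℕ) (hK : K = (L+1)/2) (α : Fin L → ℝ) :
    PS (J := K) (fun j k => if h : (j:ℕ) < L ∧ (k:ℕ) < L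
    then Real.sign (α ⟨(k:ℕ), h.2⟩ - α ⟨(j:ℕ), h.1⟩)
    else Real.sign (((k:ℕ):ℝ) - ((j:ℕ):ℝ))) =
    (∏ j : Fin L, ∏ k ∈ Finset.Ioi j, Real.sign (α k - α j)) * (2^K * (Nat.factorial K : ℝ)) := by
  have hc : L = 2*K ∨ 2*K = L+1 := by omega
  rcases hc with rfl | hc
  · rw [← even_case]
    congr 1
    funext j k
    rw [dif_pos ⟨j.2, k.2⟩]
  · let β : Fin (2*K) → ℝ := fun j => if h : (j:ℕ) < L then α ⟨j, h⟩ else 1 + ∑ i, |α i|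
    have hb1 : ∀ (j : Fin (2*K)) (h : (j:ℕ) < L), β j = α ⟨j, h⟩ := fun j h => dif_pos h
    have hb2 : ∀ (j : Fin (2*K)) (_ : ¬ (j:ℕ) < L), β j = 1 + ∑ i, |α i| := fun j h => dif_neg h
    have hlt : ∀ i j : Fin (2*K), (i:ℕ) < L → (j:ℕ) = L → β i < β j := by
      intro i j hi hj
      rw [hb1 i hi, hb2 j (by omega)]
      have h1 := le_abs_self (α ⟨i, hi⟩)
      have h2 := Finset.single_le_sum (f := fun i => |α i|) (fun i _ => abs_nonneg _)
        (Finset.mem_univ (⟨i, hi⟩ : Fin L))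
      linarith
    have he := even_case K β
    rw [prod_ext' L (2*K) hc β hlt] at he
    have e1 : ∀ j : Fin L, β ⟨j, by omega⟩ = α j := fun j => hb1 ⟨j, by omega⟩ j.2
    simp only [e1] at he
    rw [← he]
    congr 1
    funext j k
    split_ifs with h
    · rw [hb1 j h.1, hb1 k h.2]
    · have hj := j.2
      have hk := k.2
      by_cases h1 : (j:ℕ) < L
      · have h2 : (k:ℕ) = L := by omega
        rw [Real.sign_of_pos (sub_pos.2 (hlt j k h1 h2)), Real.sign_of_pos]
        rw [sub_pos]; exact_mod_cast (by omega : (j:ℕ) < k)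
      · by_cases h2 : (k:ℕ) < L
        · rw [Real.sign_of_neg (sub_neg.2 (hlt k j h2 (by omega))), Real.sign_of_neg]
          rw [sub_neg]; exact_mod_cast (by omega : (k:ℕ) < j)
        · have : j = k := Fin.ext (by omega)
          subst this
          simp

/-- For every `α ∈ ℝ^L`, `∏_{1 ≤ j < k ≤ L} sgn(α_k − α_j) = Pf T^α`. -/
theorem prod_sign_eq_pf_T (L : ℕ) (hL : 1 ≤ L) (α : Fin L → ℝ) :
    (∏ j : Fin L, ∏ k ∈ Finset.Ioi j, Real.sign (α k - α j)) = pf (Tmat α) := by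
  have h := gen_case L ((L+1)/2) rfl α
  have h2 : pf (Tmat α) = ((2:ℝ)^((L+1)/2) * (Nat.factorial ((L+1)/2) : ℝ))⁻¹ *
    ((∏ j : Fin L, ∏ k ∈ Finset.Ioi j, Real.sign (α k - α j)) *
      (2^((L+1)/2) * (Nat.factorial ((L+1)/2) : ℝ))) := by
    rw [← h]; rfl
  have h3 : ((2:ℝ)^((L+1)/2) * (Nat.factorial ((L+1)/2) : ℝ)) ≠ 0 := by positivity
  rw [h2]
  field_simp

end
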